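/- arXiv:1701.06347 — 2 statements merged into one kernel-verified Lean document; each statement's English description precedes it below -/
import Mathlib

section
/- Fix α>0, α≠1, and a σ-finite measure μ. Let (pₙ) and p be probability densities with respect to μ with 0 < ∫ pₙ^α dμ < ∞ for all n and 0 < ∫ p^α dμ < ∞, and suppose ∫ |pₙ − p|^α dμ → 0 (convergence in the L^α(μ) metric). Then ‖pₙ‖ → ‖p‖, where ‖p‖ = (∫ p^α dμ)^{1/α}, and the α-scaled densities converge in L¹(μ): ∫ | (pₙ/‖pₙ‖)^α − (p/‖p‖)^α | dμ → 0. -/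
open MeasureTheory Real Filter

/-- For nonnegative reals, `|a ^ α - b ^ α|` is at most a small multiple of `b ^ α` plus a large
multiple of `|a - b| ^ α`. -/
theorem exists_abs_rpow_sub_rpow_le {α ε : ℝ} (hα : 0 < α) (hε : 0 < ε) :
    ∃ C : ℝ, ∀ a b : ℝ, 0 ≤ a → 0 ≤ b → |a ^ α - b ^ α| ≤ ε * b ^ α + C * |a - b| ^ α := by
  have hc : ContinuousAt (fun t : ℝ => t ^ α) 1 :=
    Real.continuousAt_rpow_const 1 α (Or.inl one_ne_zero)
  obtain ⟨δ, hδ, h⟩ := Metric.continuousAt_iff.1 hc ε hε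
  simp only [Real.dist_eq, Real.one_rpow] at h
  refine ⟨(1 + 1 / δ) ^ α, fun a b ha hb => ?_⟩
  have hbα : 0 ≤ b ^ α := Real.rpow_nonneg hb α
  have haα : 0 ≤ a ^ α := Real.rpow_nonneg ha α
  by_cases hab : |a - b| < δ * b
  · have hb0 : 0 < b := pos_of_mul_pos_right ((abs_nonneg _).trans_lt hab) hδ.le
    have ht : |a / b - 1| < δ := by
      rw [div_sub_one hb0.ne', abs_div, abs_of_pos hb0, div_lt_iff₀ hb0]
      exact hab
    have h1 := (h ht).le
    rw [Real.div_rpow ha hb, div_sub_one (Real.rpow_pos_of_pos hb0 α).ne', abs_div,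
      abs_of_nonneg hbα, div_le_iff₀ (Real.rpow_pos_of_pos hb0 α)] at h1
    have : 0 ≤ (1 + 1 / δ) ^ α * |a - b| ^ α := by positivity
    linarith
  · push Not at hab
    have hb1 : b ≤ 1 / δ * |a - b| := by
      rw [one_div_mul_eq_div, le_div_iff₀ hδ]
      linarith
    have hle : ∀ c : ℝ, 0 ≤ c → c ≤ (1 + 1 / δ) * |a - b| →
        c ^ α ≤ (1 + 1 / δ) ^ α * |a - b| ^ α := fun c hc hc' => by
      rw [← Real.mul_rpow (by positivity) (abs_nonneg _)]
      exact Real.rpow_le_rpow hc hc' hα.le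
    have h2 := hle a ha (by linarith [le_abs_self (a - b)])
    have h3 := hle b hb (by linarith [abs_nonneg (a - b)])
    have : 0 ≤ ε * b ^ α := by positivity
    rw [abs_le]
    constructor <;> linarith

/-- The difference of two nonnegative functions with integrable `α`-th powers has an integrable
`α`-th power. -/
theorem integrable_abs_sub_rpow {X : Type*} [MeasurableSpace X] {μ : Measure X} {α : ℝ}
    (hα : 0 < α) {f g : X → ℝ} (hf : Measurable f) (hg : Measurable g)
    (hf0 : ∀ x, 0 ≤ f x) (hg0 : ∀ x, 0 ≤ g x)
    (hfi : Integrable (fun x => f x ^ α) μ) (hgi : Integrable (fun x => g x ^ α) μ) :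
    Integrable (fun x => |f x - g x| ^ α) μ := by
  have hm : Measurable fun x => |f x - g x| := (hf.sub hg).abs
  refine (hfi.add hgi).mono' (hm.pow_const α).aestronglyMeasurable
    (Eventually.of_forall fun x => ?_)
  rw [Real.norm_of_nonneg (by positivity), Pi.add_apply]
  have h1 := Real.rpow_nonneg (hf0 x) α
  have h2 := Real.rpow_nonneg (hg0 x) α
  rcases le_total (f x) (g x) with h | h
  · have := Real.rpow_le_rpow (abs_nonneg (f x - g x))
      (show |f x - g x| ≤ g x by rw [abs_le]; constructor <;> linarith [hf0 x]) hα.le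
    linarith
  · have := Real.rpow_le_rpow (abs_nonneg (f x - g x))
      (show |f x - g x| ≤ f x by rw [abs_le]; constructor <;> linarith [hg0 x]) hα.le
    linarith

/-- Convergence in the `L^α` metric of nonnegative functions implies `L¹` convergence of their
`α`-th powers. -/
theorem tendsto_integral_abs_rpow_sub_rpow {X : Type*} [MeasurableSpace X] {μ : Measure X} {α : ℝ}
    (hα : 0 < α) {p : ℕ → X → ℝ} {q : X → ℝ}
    (hp_meas : ∀ n, Measurable (p n)) (hq_meas : Measurable q)
    (hp_nonneg : ∀ n x, 0 ≤ p n x) (hq_nonneg : ∀ x, 0 ≤ q x)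
    (hp_int : ∀ n, Integrable (fun x => p n x ^ α) μ) (hq_int : Integrable (fun x => q x ^ α) μ)
    (h : Tendsto (fun n => ∫ x, |p n x - q x| ^ α ∂μ) atTop (nhds 0)) :
    Tendsto (fun n => ∫ x, |p n x ^ α - q x ^ α| ∂μ) atTop (nhds 0) := by
  have hnn : ∀ n, 0 ≤ ∫ x, |p n x ^ α - q x ^ α| ∂μ := fun n =>
    integral_nonneg fun x => abs_nonneg _
  have hQ : 0 ≤ ∫ x, q x ^ α ∂μ := integral_nonneg fun x => Real.rpow_nonneg (hq_nonneg x) α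
  refine tendsto_order.2 ⟨fun a ha => Eventually.of_forall fun n => ha.trans_le (hnn n),
    fun ε hε => ?_⟩
  obtain ⟨η, hη, hηε⟩ : ∃ η : ℝ, 0 < η ∧ η * ∫ x, q x ^ α ∂μ < ε := by
    refine ⟨ε / ((∫ x, q x ^ α ∂μ) + 1), by positivity, ?_⟩
    rw [div_mul_eq_mul_div, div_lt_iff₀ (by positivity)]
    linarith
  obtain ⟨C, hC⟩ := exists_abs_rpow_sub_rpow_le hα hη
  have hlim : Tendsto (fun n => η * ∫ x, q x ^ α ∂μ + C * ∫ x, |p n x - q x| ^ α ∂μ) atTop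
      (nhds (η * ∫ x, q x ^ α ∂μ)) := by
    simpa using (h.const_mul C).const_add (η * ∫ x, q x ^ α ∂μ)
  filter_upwards [hlim.eventually_lt_const hηε] with n hn
  refine lt_of_le_of_lt ?_ hn
  have hi := integrable_abs_sub_rpow hα (hp_meas n) hq_meas (hp_nonneg n) hq_nonneg (hp_int n)
    hq_int
  rw [← integral_const_mul, ← integral_const_mul,
    ← integral_add (hq_int.const_mul η) (hi.const_mul C)]
  exact integral_mono ((hp_int n).sub hq_int).abs ((hq_int.const_mul η).add (hi.const_mul C))
    fun x => hC _ _ (hp_nonneg n x) (hq_nonneg x)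

/-- If `fₙ → g` in `L¹`, with positive integrals, then the normalized functions converge
in `L¹`. -/
theorem tendsto_integral_abs_div_integral_sub {X : Type*} [MeasurableSpace X] {μ : Measure X}
    {f : ℕ → X → ℝ} {g : X → ℝ} (hf : ∀ n, Integrable (f n) μ) (hg : Integrable g μ)
    (hg_pos : 0 < ∫ x, g x ∂μ)
    (hlim : Tendsto (fun n => ∫ x, f n x ∂μ) atTop (nhds (∫ x, g x ∂μ)))
    (h : Tendsto (fun n => ∫ x, |f n x - g x| ∂μ) atTop (nhds 0)) :
    Tendsto (fun n => ∫ x, |f n x / (∫ y, f n y ∂μ) - g x / (∫ y, g y ∂μ)| ∂μ) atTop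
      (nhds 0) := by
  have hinv := hlim.inv₀ hg_pos.ne'
  have hbound : Tendsto (fun n => |(∫ y, f n y ∂μ)⁻¹| * (∫ x, |f n x - g x| ∂μ) +
      |(∫ y, f n y ∂μ)⁻¹ - (∫ y, g y ∂μ)⁻¹| * ∫ x, |g x| ∂μ) atTop (nhds 0) := by
    simpa using (hinv.abs.mul h).add
      ((hinv.sub_const (∫ y, g y ∂μ)⁻¹).abs.mul_const (∫ x, |g x| ∂μ))
  refine squeeze_zero (fun n => integral_nonneg fun x => abs_nonneg _) (fun n => ?_) hbound
  have h1 := ((hf n).sub hg).abs.const_mul |(∫ y, f n y ∂μ)⁻¹|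
  have h2 := hg.abs.const_mul |(∫ y, f n y ∂μ)⁻¹ - (∫ y, g y ∂μ)⁻¹|
  rw [← integral_const_mul, ← integral_const_mul]
  refine (integral_mono (((hf n).div_const _).sub (hg.div_const _)).abs (h1.add h2)
    fun x => ?_).trans_eq (integral_add h1 h2)
  simp only [Pi.add_apply, Pi.sub_apply, ← abs_mul]
  refine le_trans (le_of_eq ?_) (abs_add_le _ _)
  congr 1
  ring

/-- For `α > 0`, `α ≠ 1`, probability densities `pₙ`, `p` with finite positive
`α`-th power integrals, if `∫ |pₙ − p|^α dμ → 0` (convergence in the `L^α(μ)` metric), then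
`‖pₙ‖ → ‖p‖` where `‖p‖ = (∫ p^α dμ)^{1/α}`, and the `α`-scaled densities converge in `L¹(μ)`:
`∫ |(pₙ/‖pₙ‖)^α − (p/‖p‖)^α| dμ → 0`. -/
theorem scaled_L1_tendsto_of_Lalpha_tendsto
    {X : Type*} [MeasurableSpace X] (μ : Measure X) [SigmaFinite μ]
    (α : ℝ) (hα : 0 < α) (hα1 : α ≠ 1)
    (p : ℕ → X → ℝ) (q : X → ℝ)
    (hp_meas : ∀ n, Measurable (p n)) (hq_meas : Measurable q)
    (hp_nonneg : ∀ n x, 0 ≤ p n x) (hq_nonneg : ∀ x, 0 ≤ q x)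
    (hp_one : ∀ n, ∫ x, p n x ∂μ = 1) (hq_one : ∫ x, q x ∂μ = 1)
    (hpα_int : ∀ n, Integrable (fun x => p n x ^ α) μ)
    (hqα_int : Integrable (fun x => q x ^ α) μ)
    (hpα_pos : ∀ n, 0 < ∫ x, p n x ^ α ∂μ) (hqα_pos : 0 < ∫ x, q x ^ α ∂μ)
    (hLα : Tendsto (fun n => ∫ x, |p n x - q x| ^ α ∂μ) atTop (nhds 0)) :
    Tendsto (fun n => (∫ x, p n x ^ α ∂μ) ^ (1/α)) atTop
        (nhds ((∫ x, q x ^ α ∂μ) ^ (1/α)))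
    ∧ Tendsto (fun n => ∫ x,
        |(p n x / (∫ y, p n y ^ α ∂μ) ^ (1/α)) ^ α
          - (q x / (∫ y, q y ^ α ∂μ) ^ (1/α)) ^ α| ∂μ) atTop (nhds 0) := by
  have hL1 := tendsto_integral_abs_rpow_sub_rpow hα hp_meas hq_meas hp_nonneg hq_nonneg hpα_int
    hqα_int hLα
  have hlim : Tendsto (fun n => ∫ x, p n x ^ α ∂μ) atTop (nhds (∫ x, q x ^ α ∂μ)) := by
    rw [tendsto_iff_norm_sub_tendsto_zero]
    refine squeeze_zero (fun n => norm_nonneg _) (fun n => ?_) hL1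
    rw [← integral_sub (hpα_int n) hqα_int]
    exact norm_integral_le_integral_norm _
  refine ⟨hlim.rpow_const (Or.inl hqα_pos.ne'), ?_⟩
  have hscale : ∀ a S : ℝ, 0 ≤ a → 0 < S → (a / S ^ (1 / α)) ^ α = a ^ α / S :=
    fun a S ha hS => by
      rw [Real.div_rpow ha (by positivity), ← Real.rpow_mul hS.le, one_div_mul_cancel hα.ne',
        Real.rpow_one]
  simp only [hscale _ _ (hp_nonneg _ _) (hpα_pos _), hscale _ _ (hq_nonneg _) hqα_pos]
  exact tendsto_integral_abs_div_integral_sub hpα_int hqα_int hqα_pos hlim hL1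
end

section
/- Fix α>0, α≠1, and a σ-finite measure μ. Let Q and P₊ be probability measures ≪ μ with densities having finite positive α-th power integrals, and let 𝔼 be a set of such probability measures. If the Pythagorean inequality 𝓘_α(P,Q) ≥ 𝓘_α(P,P₊) + 𝓘_α(P₊,Q) holds for all P ∈ 𝔼, then for all P ∈ 𝔼 the corresponding inequality holds for Rényi divergence of order 1/α between the α-scaled measures: D_{1/α}(P^{(α)} ‖ Q^{(α)}) ≥ D_{1/α}(P^{(α)} ‖ P₊^{(α)}) + D_{1/α}(P₊^{(α)} ‖ Q^{(α)}); and conversely, the Rényi Pythagorean inequality for all members of 𝔼^{(α)} implies the relative-α-entropy Pythagorean inequality for all members of 𝔼. -/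
open MeasureTheory Real

/-- Relative `α`-entropy `𝓘_α(P,Q)` in terms of the `μ`-densities `p, q`. -/
noncomputable def relAlphaEntropy {X : Type*} [MeasurableSpace X]
    (μ : Measure X) (α : ℝ) (p q : X → ℝ) : ℝ :=
  (α / (1 - α)) * Real.log (∫ x,
    (p x / (∫ y, p y ^ α ∂μ) ^ (1/α)) * (q x / (∫ y, q y ^ α ∂μ) ^ (1/α)) ^ (α - 1) ∂μ)

/-- Rényi divergence of order `β` in terms of the `μ`-densities. -/
noncomputable def renyiDiv {X : Type*} [MeasurableSpace X]
    (μ : Measure X) (β : ℝ) (p q : X → ℝ) : ℝ :=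
  (1 / (β - 1)) * Real.log (∫ x, p x ^ β * q x ^ (1 - β) ∂μ)

/-- The `α`-scaled density `p^{(α)} = p^α / ∫ p^α dμ`. -/
noncomputable def scaledDensity {X : Type*} [MeasurableSpace X]
    (μ : Measure X) (α : ℝ) (p : X → ℝ) : X → ℝ :=
  fun x => p x ^ α / ∫ y, p y ^ α ∂μ

/-- The relative `α`-entropy is the Rényi divergence of order `1/α` between the `α`-scaled
densities. -/
theorem renyiDiv_scaledDensity {X : Type*} [MeasurableSpace X] (μ : Measure X) {α : ℝ}
    (hα : 0 < α) {p q : X → ℝ} (hp : ∀ x, 0 ≤ p x) (hq : ∀ x, 0 ≤ q x) :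
    renyiDiv μ (1 / α) (scaledDensity μ α p) (scaledDensity μ α q) =
      relAlphaEntropy μ α p q := by
  have scaled_eq : ∀ {f : X → ℝ}, (∀ x, 0 ≤ f x) → ∀ x,
      0 ≤ f x / (∫ y, f y ^ α ∂μ) ^ (1 / α) ∧
      scaledDensity μ α f x = (f x / (∫ y, f y ^ α ∂μ) ^ (1 / α)) ^ α := by
    intro f hf x
    have hN : 0 ≤ ∫ y, f y ^ α ∂μ := integral_nonneg fun y => rpow_nonneg (hf y) α
    refine ⟨div_nonneg (hf x) (rpow_nonneg hN _), ?_⟩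
    rw [div_rpow (hf x) (rpow_nonneg hN _), ← rpow_mul hN, one_div_mul_cancel hα.ne', rpow_one,
      scaledDensity]
  have hcoeff : 1 / (1 / α - 1) = α / (1 - α) := by
    rw [div_sub_one hα.ne', one_div_div]
  unfold renyiDiv relAlphaEntropy
  rw [hcoeff]
  congr 3 with x
  obtain ⟨hp0, hpx⟩ := scaled_eq hp x
  obtain ⟨hq0, hqx⟩ := scaled_eq hq x
  rw [hpx, hqx, ← rpow_mul hp0, ← rpow_mul hq0, mul_one_div_cancel hα.ne', rpow_one, mul_sub,
    mul_one_div_cancel hα.ne', mul_one]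

/-- The Pythagorean inequality
`𝓘_α(P,Q) ≥ 𝓘_α(P,P₊) + 𝓘_α(P₊,Q)` holds for all `P ∈ 𝔼` if and only if the corresponding
Pythagorean inequality for the Rényi divergence of order `1/α` holds between the `α`-scaled
measures for all members of `𝔼^{(α)}`. -/
theorem pythagorean_equivalence
    {X : Type*} [MeasurableSpace X] (μ : Measure X) [SigmaFinite μ]
    (α : ℝ) (hα : 0 < α) (hα1 : α ≠ 1)
    (q pStar : X → ℝ)
    (hq_meas : Measurable q) (hq_nonneg : ∀ x, 0 ≤ q x) (hq_one : ∫ x, q x ∂μ = 1)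
    (hqα_int : Integrable (fun x => q x ^ α) μ) (hqα_pos : 0 < ∫ x, q x ^ α ∂μ)
    (hs_meas : Measurable pStar) (hs_nonneg : ∀ x, 0 ≤ pStar x)
    (hs_one : ∫ x, pStar x ∂μ = 1)
    (hsα_int : Integrable (fun x => pStar x ^ α) μ) (hsα_pos : 0 < ∫ x, pStar x ^ α ∂μ)
    (𝓔 : Set (X → ℝ))
    (hmeas : ∀ p ∈ 𝓔, Measurable p) (hnonneg : ∀ p ∈ 𝓔, ∀ x, 0 ≤ p x)
    (hone : ∀ p ∈ 𝓔, ∫ x, p x ∂μ = 1)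
    (hint : ∀ p ∈ 𝓔, Integrable (fun x => p x ^ α) μ)
    (hpos : ∀ p ∈ 𝓔, 0 < ∫ x, p x ^ α ∂μ) :
    (∀ p ∈ 𝓔, relAlphaEntropy μ α p q ≥
        relAlphaEntropy μ α p pStar + relAlphaEntropy μ α pStar q) ↔
    (∀ p ∈ 𝓔, renyiDiv μ (1/α) (scaledDensity μ α p) (scaledDensity μ α q) ≥
        renyiDiv μ (1/α) (scaledDensity μ α p) (scaledDensity μ α pStar)
          + renyiDiv μ (1/α) (scaledDensity μ α pStar) (scaledDensity μ α q)) := by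
  refine forall₂_congr fun p hp => ?_
  rw [renyiDiv_scaledDensity μ hα (hnonneg p hp) hq_nonneg,
    renyiDiv_scaledDensity μ hα (hnonneg p hp) hs_nonneg,
    renyiDiv_scaledDensity μ hα hs_nonneg hq_nonneg]
end
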